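/- arXiv:math-ph/0305001 — 3 statements merged into one kernel-verified Lean document; each statement's English description precedes it below -/
import Mathlib

section
/- Stream function construction for the Asymmetric Bloch wall: on the closed strip ℝ × [−1/2, 1/2] there exists a smooth function ψ with |∇ψ|² ≤ 1 everywhere, ψ = 0 on the two boundary lines {x₃ = ±1/2} and ψ = 0 for all sufficiently large |x₁|, together with a continuous curve γ contained in the closed strip connecting the point (0, −1/2) to the point (0, 1/2) on which |∇ψ|² = 1 identically. -/
open MeasureTheory Real Set Filter
open scoped ENNReal

noncomputable section

/-- Partial derivative with respect to the first (horizontal) variable `x₁`. -/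
def pd1 (f : ℝ × ℝ → ℝ) (x : ℝ × ℝ) : ℝ := deriv (fun s => f (s, x.2)) x.1

/-- Partial derivative with respect to the second (vertical) variable `x₃`. -/
def pd3 (f : ℝ × ℝ → ℝ) (x : ℝ × ℝ) : ℝ := deriv (fun s => f (x.1, s)) x.2

/-- Squared length of the gradient `|∇f|² = (∂f/∂x₁)² + (∂f/∂x₃)²`. -/
def gradSq (f : ℝ × ℝ → ℝ) (x : ℝ × ℝ) : ℝ := (pd1 f x)^2 + (pd3 f x)^2

/-- The film cross-section `Ω = ℝ × (−t/2, t/2)`. -/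
def Strip (t : ℝ) : Set (ℝ × ℝ) := Set.univ ×ˢ Set.Ioo (-(t/2)) (t/2)

/-- An admissible magnetization: a smooth map `m = (m₁,m₂,m₃) : Ω → S²` connecting the
two end states `m₂ = ∓1` at `x₁ = ∓∞`. -/
structure Admissible (t : ℝ) (m1 m2 m3 : ℝ × ℝ → ℝ) : Prop where
  smooth1 : ContDiffOn ℝ (⊤ : ℕ∞) m1 (Strip t)
  smooth2 : ContDiffOn ℝ (⊤ : ℕ∞) m2 (Strip t)
  smooth3 : ContDiffOn ℝ (⊤ : ℕ∞) m3 (Strip t)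
  unit : ∀ x ∈ Strip t, (m1 x)^2 + (m2 x)^2 + (m3 x)^2 = 1
  limPos : ∀ x3 ∈ Set.Ioo (-(t/2)) (t/2),
      Filter.Tendsto (fun x1 => m2 (x1, x3)) Filter.atTop (nhds 1)
  limNeg : ∀ x3 ∈ Set.Ioo (-(t/2)) (t/2),
      Filter.Tendsto (fun x1 => m2 (x1, x3)) Filter.atBot (nhds (-1))

/-- `u` is a stray-field potential for `(m₁, m₃)`: `∇u ∈ L²(ℝ²)` and the weak form of the
static Maxwell equations holds against every smooth compactly supported test function. -/
def IsStrayPotential (t : ℝ) (m1 m3 u : ℝ × ℝ → ℝ) : Prop :=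
  Integrable (gradSq u) volume ∧
  ∀ ζ : ℝ × ℝ → ℝ, ContDiff ℝ (⊤ : ℕ∞) ζ → HasCompactSupport ζ →
    ∫ x in Strip t, (m1 x * pd1 ζ x + m3 x * pd3 ζ x)
      = ∫ x, (pd1 u x * pd1 ζ x + pd3 u x * pd3 ζ x)

/-- The micromagnetic specific wall energy `E(m,u)`, valued in `[0,∞]`. -/
def energy (t d Q : ℝ) (m1 m2 m3 u : ℝ × ℝ → ℝ) : ℝ≥0∞ :=
  ENNReal.ofReal (d^2) *
      ∫⁻ x in Strip t, ENNReal.ofReal (gradSq m1 x + gradSq m2 x + gradSq m3 x)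
  + ENNReal.ofReal Q * ∫⁻ x in Strip t, ENNReal.ofReal ((m1 x)^2 + (m3 x)^2)
  + ∫⁻ x, ENNReal.ofReal (gradSq u x)

/-- Vertical average `f̄(x₁) = (1/t) ∫_{−t/2}^{t/2} f(x₁,x₃) dx₃`. -/
def vavg (t : ℝ) (f : ℝ × ℝ → ℝ) (x1 : ℝ) : ℝ :=
  (1/t) * ∫ x3 in Set.Ioo (-(t/2)) (t/2), f (x1, x3)

/-- The closed unit-thickness strip `ℝ × [−1/2, 1/2]`. -/
def ClosedStrip : Set (ℝ × ℝ) := Set.univ ×ˢ Set.Icc (-(1/2) : ℝ) (1/2)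

theorem hda {f g : ℝ → ℝ} {a b x : ℝ} (h : HasDerivAt g b x) (hf : ∀ z, f z = g z)
    (ha : a = b) : HasDerivAt f a x := by
  have : f = g := funext hf
  rw [this, ha]; exact h

theorem exists_soft : ∃ s σ : ℝ → ℝ, ContDiff ℝ (⊤ : ℕ∞) s ∧ (∀ t, HasDerivAt s (σ t) t) ∧
    (∀ t, 0 ≤ σ t) ∧ (∀ t, σ t ≤ 1) ∧ Monotone σ ∧
    (∀ t, 1/32 ≤ t → s t = t ∧ σ t = 1) ∧ (∀ t, t ≤ -(1/32) → s t = 0 ∧ σ t = 0) := by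
  have hc : Continuous smoothTransition := smoothTransition.continuous
  have hI : ∀ a b, IntervalIntegrable smoothTransition volume a b := fun a b =>
    hc.intervalIntegrable a b
  let F : ℝ → ℝ := fun t => ∫ u in (0:ℝ)..t, smoothTransition u
  have hF : ∀ t, HasDerivAt F (smoothTransition t) t := fun t =>
    intervalIntegral.integral_hasDerivAt_right (hI 0 t)
      hc.stronglyMeasurable.stronglyMeasurableAtFilter hc.continuousAt
  have hFs : ContDiff ℝ (⊤ : ℕ∞) F := by
    refine contDiff_infty_iff_deriv.2 ⟨fun t => (hF t).differentiableAt, ?_⟩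
    have : deriv F = smoothTransition := funext fun t => (hF t).deriv
    rw [this]; exact smoothTransition.contDiff
  have hF0 : ∀ t ≤ 0, F t = 0 := by
    intro t ht
    have : F t = ∫ u in (0:ℝ)..t, (0:ℝ) := by
      refine intervalIntegral.integral_congr fun u hu => ?_
      rw [uIcc_of_ge ht] at hu
      exact smoothTransition.zero_of_nonpos hu.2
    simpa using this
  have hF1 : ∀ t, 1 ≤ t → F t = F 1 + (t - 1) := by
    intro t ht
    have h1 : F t = F 1 + ∫ u in (1:ℝ)..t, smoothTransition u :=
      (intervalIntegral.integral_add_adjacent_intervals (hI 0 1) (hI 1 t)).symm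
    have h2 : (∫ u in (1:ℝ)..t, smoothTransition u) = ∫ u in (1:ℝ)..t, (1:ℝ) := by
      refine intervalIntegral.integral_congr fun u hu => ?_
      rw [uIcc_of_le ht] at hu
      exact smoothTransition.one_of_one_le hu.1
    rw [h1, h2]; simp
  have hc0 : 0 ≤ F 1 := intervalIntegral.integral_nonneg (by norm_num)
    fun u _ => smoothTransition.nonneg u
  have hc1 : F 1 ≤ 1 := by
    have : F 1 ≤ ∫ u in (0:ℝ)..1, (1:ℝ) :=
      intervalIntegral.integral_mono_on (by norm_num) (hI 0 1) (by simp)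
        fun u _ => smoothTransition.le_one u
    simpa using this
  refine ⟨fun t => F (32 * t + (1 - F 1)) / 32, fun t => smoothTransition (32 * t + (1 - F 1)),
    ?_, ?_, fun t => smoothTransition.nonneg _, fun t => smoothTransition.le_one _, ?_, ?_, ?_⟩
  · exact (hFs.comp (by fun_prop)).div_const _
  · intro t
    have h1 : HasDerivAt (fun t : ℝ => 32 * t + (1 - F 1)) 32 t := by
      simpa using ((hasDerivAt_id t).const_mul 32).add_const (1 - F 1)
    have := ((hF _).comp t h1).div_const 32
    exact hda this (fun z => rfl) (by ring)
  · intro a b hab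
    exact smoothTransition.monotone (by linarith)
  · intro t ht
    refine ⟨?_, smoothTransition.one_of_one_le (by linarith)⟩
    show F (32 * t + (1 - F 1)) / 32 = t
    rw [hF1 _ (by linarith)]; ring
  · intro t ht
    refine ⟨?_, smoothTransition.zero_of_nonpos (by linarith)⟩
    show F (32 * t + (1 - F 1)) / 32 = 0
    rw [hF0 _ (by linarith)]; ring

def sS : ℝ → ℝ := exists_soft.choose
def sG : ℝ → ℝ := exists_soft.choose_spec.choose

theorem soft_spec : ContDiff ℝ (⊤ : ℕ∞) sS ∧ (∀ t, HasDerivAt sS (sG t) t) ∧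
    (∀ t, 0 ≤ sG t) ∧ (∀ t, sG t ≤ 1) ∧ Monotone sG ∧
    (∀ t, 1/32 ≤ t → sS t = t ∧ sG t = 1) ∧ (∀ t, t ≤ -(1/32) → sS t = 0 ∧ sG t = 0) :=
  exists_soft.choose_spec.choose_spec

theorem sS_smooth : ContDiff ℝ (⊤ : ℕ∞) sS := soft_spec.1
theorem sS_deriv (t : ℝ) : HasDerivAt sS (sG t) t := soft_spec.2.1 t
theorem sG_nonneg (t : ℝ) : 0 ≤ sG t := soft_spec.2.2.1 t
theorem sG_le (t : ℝ) : sG t ≤ 1 := soft_spec.2.2.2.1 t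
theorem sG_mono : Monotone sG := soft_spec.2.2.2.2.1
theorem sS_hi {t : ℝ} (h : 1/32 ≤ t) : sS t = t := (soft_spec.2.2.2.2.2.1 t h).1
theorem sG_hi {t : ℝ} (h : 1/32 ≤ t) : sG t = 1 := (soft_spec.2.2.2.2.2.1 t h).2
theorem sS_lo {t : ℝ} (h : t ≤ -(1/32)) : sS t = 0 := (soft_spec.2.2.2.2.2.2 t h).1
theorem sG_lo {t : ℝ} (h : t ≤ -(1/32)) : sG t = 0 := (soft_spec.2.2.2.2.2.2 t h).2

theorem sS_mono : Monotone sS :=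
  monotone_of_deriv_nonneg (fun t => (sS_deriv t).differentiableAt)
    fun t => by rw [(sS_deriv t).deriv]; exact sG_nonneg t

theorem sS_nonneg (t : ℝ) : 0 ≤ sS t := by
  have h := sS_mono (min_le_left t (-(1/32)))
  rwa [sS_lo (min_le_right _ _)] at h

theorem sS_le (t : ℝ) : sS t ≤ sG t * (t + 1/32) := by
  rcases le_or_gt t (-(1/32)) with h | h
  · rw [sS_lo h, sG_lo h]; simp
  · obtain ⟨c, hc, he⟩ := exists_hasDerivAt_eq_slope sS sG h sS_smooth.continuous.continuousOn
      (fun x _ => sS_deriv x)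
    rw [sS_lo le_rfl, eq_div_iff (by linarith)] at he
    have : sG c ≤ sG t := sG_mono hc.2.le
    nlinarith

/-- profile functions -/
def wR (y : ℝ) : ℝ := (1/2) * sS (y - 1/4)
def wR' (y : ℝ) : ℝ := (1/2) * sG (y - 1/4)
def wS (y : ℝ) : ℝ := sS (1/2 - y - wR y)
def wT (y : ℝ) : ℝ := 1/2 - y - wS y
def wT' (y : ℝ) : ℝ := -1 + sG (1/2 - y - wR y) * (1 + wR' y)
def wE (y : ℝ) : ℝ := wS y / (1/2 - y)
def wH (y : ℝ) : ℝ := (sG (1/2 - y - wR y) * (1 + wR' y) * (1/2 - y) - wS y) / (1/2 - y)^2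

theorem wR_deriv (y : ℝ) : HasDerivAt wR (wR' y) y := by
  have h1 : HasDerivAt (fun y : ℝ => y - 1/4) 1 y := (hasDerivAt_id y).sub_const _
  have := ((sS_deriv _).comp y h1).const_mul (1/2)
  exact hda this (fun z => rfl) (by simp [wR'])

theorem wS_deriv (y : ℝ) : HasDerivAt wS (-(sG (1/2 - y - wR y) * (1 + wR' y))) y := by
  have h1 : HasDerivAt (fun y : ℝ => 1/2 - y - wR y) (-1 - wR' y) y :=
    ((hasDerivAt_id y).const_sub _).sub (wR_deriv y)
  have := (sS_deriv _).comp y h1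
  exact hda this (fun z => rfl) (by ring)

theorem wT_deriv (y : ℝ) : HasDerivAt wT (wT' y) y := by
  have := ((hasDerivAt_id y).const_sub (1/2)).sub (wS_deriv y)
  exact hda this (fun z => rfl) (by simp only [wT']; ring)

theorem wE_deriv {y : ℝ} (hy : y < 1/2) : HasDerivAt wE (-wH y) y := by
  have := (wS_deriv y).div ((hasDerivAt_id y).const_sub (1/2)) (by simp; linarith)
  exact hda this (fun z => rfl) (by simp only [wH, id]; ring)

theorem wR_smooth : ContDiff ℝ (⊤ : ℕ∞) wR :=
  contDiff_const.mul (sS_smooth.comp (by fun_prop))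

theorem wS_smooth : ContDiff ℝ (⊤ : ℕ∞) wS :=
  sS_smooth.comp ((contDiff_const.sub contDiff_id).sub wR_smooth)

theorem wT_smooth : ContDiff ℝ (⊤ : ℕ∞) wT :=
  (contDiff_const.sub contDiff_id).sub wS_smooth

theorem wR_nonneg (y : ℝ) : 0 ≤ wR y := mul_nonneg (by norm_num) (sS_nonneg _)
theorem wR'_nonneg (y : ℝ) : 0 ≤ wR' y := mul_nonneg (by norm_num) (sG_nonneg _)
theorem wR'_le (y : ℝ) : wR' y ≤ 1/2 := by
  have := sG_le (y - 1/4); unfold wR'; linarith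

theorem wR_lo {y : ℝ} (hy : y ≤ 7/32) : wR y = 0 ∧ wR' y = 0 := by
  unfold wR wR'; rw [sS_lo (by linarith), sG_lo (by linarith)]; simp

theorem wR_hi {y : ℝ} (hy : 9/32 ≤ y) : wR y = (1/2) * (y - 1/4) := by
  unfold wR; rw [sS_hi (by linarith)]

theorem w_lo {y : ℝ} (hy : y ≤ 7/32) :
    wS y = 1/2 - y ∧ wT y = 0 ∧ wT' y = 0 ∧ wE y = 1 ∧ wH y = 0 := by
  obtain ⟨h1, h2⟩ := wR_lo hy
  have h3 : wS y = 1/2 - y := by unfold wS; rw [h1, sS_hi (by linarith)]; ring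
  have h4 : sG (1/2 - y - wR y) = 1 := sG_hi (by rw [h1]; linarith)
  refine ⟨h3, by unfold wT; rw [h3]; ring, by unfold wT'; rw [h4, h2]; ring, ?_, ?_⟩
  · unfold wE; rw [h3, div_self (by linarith)]
  · unfold wH; rw [h3, h4, h2]; simp

theorem w_hi {y : ℝ} (hy : 7/16 ≤ y) :
    wS y = 0 ∧ wT y = 1/2 - y ∧ wT' y = -1 ∧ wE y = 0 ∧ wH y = 0 := by
  have h1 := wR_hi (y := y) (by linarith)
  have h3 : wS y = 0 := by unfold wS; rw [h1, sS_lo (by linarith)]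
  have h4 : sG (1/2 - y - wR y) = 0 := sG_lo (by rw [h1]; linarith)
  refine ⟨h3, by unfold wT; rw [h3]; ring, by unfold wT'; rw [h4]; ring, ?_, ?_⟩
  · unfold wE; rw [h3]; simp
  · unfold wH; rw [h3, h4]; simp

/-- dichotomy -/
theorem w_dich (y : ℝ) : 1/32 ≤ 1/2 - y - wR y ∨ 1/32 ≤ wR y := by
  rcases le_or_gt (9/32) y with h | h
  · rw [wR_hi h]
    rcases le_or_gt y (3/8) with h' | h'
    · left; linarith
    · right; linarith
  · left
    have : wR y ≤ wR (9/32) := by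
      unfold wR; have := sS_mono (show y - 1/4 ≤ 9/32 - 1/4 by linarith); linarith
    rw [wR_hi le_rfl] at this
    linarith

theorem wS_nonneg (y : ℝ) : 0 ≤ wS y := sS_nonneg _

theorem wS_le' (y : ℝ) (hy : y ≤ 1/2) :
    wS y ≤ sG (1/2 - y - wR y) * (1 + wR' y) * (1/2 - y) := by
  have hR := wR_nonneg y
  have hR' := wR'_nonneg y
  have hg := sG_nonneg (1/2 - y - wR y)
  rcases w_dich y with h | h
  · unfold wS; rw [sS_hi h, sG_hi h]; nlinarith
  · have := sS_le (1/2 - y - wR y)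
    have h2 : sG (1/2 - y - wR y) * (1/2 - y - wR y + 1/32) ≤ sG (1/2 - y - wR y) * (1/2 - y) :=
      mul_le_mul_of_nonneg_left (by linarith) hg
    have h3 : 0 ≤ sG (1/2 - y - wR y) * (1/2 - y) * wR' y :=
      mul_nonneg (mul_nonneg hg (by linarith)) hR'
    unfold wS; nlinarith

theorem wS_le (y : ℝ) (hy : y ≤ 1/2) : wS y ≤ 1/2 - y := by
  have hR := wR_nonneg y
  have hg := sG_nonneg (1/2 - y - wR y)
  have hg1 := sG_le (1/2 - y - wR y)
  rcases w_dich y with h | h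
  · unfold wS; rw [sS_hi h]; linarith
  · have := sS_le (1/2 - y - wR y)
    have h2 : sG (1/2 - y - wR y) * (1/2 - y - wR y + 1/32) ≤ sG (1/2 - y - wR y) * (1/2 - y) :=
      mul_le_mul_of_nonneg_left (by linarith) hg
    unfold wS; nlinarith

theorem wE_mem {y : ℝ} (hy : y ≤ 1/2) : 0 ≤ wE y ∧ wE y ≤ 1 :=
  ⟨div_nonneg (wS_nonneg y) (by linarith), div_le_one_of_le₀ (wS_le y hy) (by linarith)⟩

theorem wH_nonneg {y : ℝ} (hy : y ≤ 1/2) : 0 ≤ wH y :=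
  div_nonneg (by have := wS_le' y hy; linarith) (sq_nonneg _)

theorem wT_mem {y : ℝ} (h0 : 0 ≤ y) (hy : y ≤ 1/2) : 0 ≤ wT y ∧ wT y ≤ 1 := by
  have := wS_le y hy; have := wS_nonneg y; unfold wT; constructor <;> linarith

theorem wT'_mem (y : ℝ) : -1 ≤ wT' y ∧ wT' y ≤ 1/2 := by
  have hR' := wR'_nonneg y
  have hR1 := wR'_le y
  have hg := sG_nonneg (1/2 - y - wR y)
  have hg1 := sG_le (1/2 - y - wR y)
  unfold wT'; constructor <;> nlinarith

theorem wT'_eq {y : ℝ} (hy : y ≤ 1/2) : wT' y = -(1 - wE y) + wH y * (1/2 - y) := by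
  rcases le_or_gt (7/16) y with h | h
  · obtain ⟨-, -, h1, h2, h3⟩ := w_hi h
    rw [h1, h2, h3]; ring
  · have : 1/2 - y ≠ 0 := by linarith
    unfold wT' wE wH
    generalize 1/2 - y = A at *
    field_simp; ring

/-- radial profile -/
def wB (r : ℝ) : ℝ := 3/8 - sS (3/8 - sS (1/2 - r))
def wW (r : ℝ) : ℝ := sG (3/8 - sS (1/2 - r)) * sG (1/2 - r)

theorem wB_deriv (r : ℝ) : HasDerivAt wB (-wW r) r := by
  have h1 : HasDerivAt (fun r : ℝ => 1/2 - r) (-1) r := (hasDerivAt_id r).const_sub _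
  have h2 := ((sS_deriv _).comp r h1).const_sub (3/8)
  have h3 := ((sS_deriv _).comp r h2).const_sub (3/8)
  exact hda h3 (fun z => rfl) (by simp [wW])

theorem wB_smooth : ContDiff ℝ (⊤ : ℕ∞) wB :=
  contDiff_const.sub (sS_smooth.comp (contDiff_const.sub (sS_smooth.comp (by fun_prop))))

theorem wW_mem (r : ℝ) : 0 ≤ wW r ∧ wW r ≤ 1 :=
  ⟨mul_nonneg (sG_nonneg _) (sG_nonneg _),
    mul_le_one₀ (sG_le _) (sG_nonneg _) (sG_le _)⟩

theorem wB_anti : Antitone wB := by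
  intro a b hab
  have h1 := sS_mono (show 1/2 - b ≤ 1/2 - a by linarith)
  have h2 := sS_mono (show 3/8 - sS (1/2 - a) ≤ 3/8 - sS (1/2 - b) by linarith)
  unfold wB; linarith

theorem wB_nonneg (r : ℝ) : 0 ≤ wB r := by
  have h2 := sS_mono (show 3/8 - sS (1/2 - r) ≤ 3/8 by linarith [sS_nonneg (1/2 - r)])
  rw [sS_hi (t := 3/8) (by norm_num)] at h2
  unfold wB; linarith

theorem wB_mid {r : ℝ} (h1 : 3/16 ≤ r) (h2 : r ≤ 15/32) : wB r = 1/2 - r ∧ wW r = 1 := by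
  unfold wB wW
  rw [sS_hi (t := 1/2 - r) (by linarith), sS_hi (by linarith), sG_hi (by linarith),
    sG_hi (by linarith)]
  constructor <;> ring

theorem wB_hi {r : ℝ} (h1 : 17/32 ≤ r) : wB r = 0 ∧ wW r = 0 := by
  unfold wB wW
  rw [sS_lo (t := 1/2 - r) (by linarith), sS_hi (by linarith), sG_lo (t := 1/2 - r) (by linarith)]
  constructor <;> ring

theorem wB_lo {r : ℝ} (h1 : r ≤ 1/16) : wB r = 3/8 := by
  unfold wB
  rw [sS_hi (t := 1/2 - r) (by linarith), sS_lo (by linarith)]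
  ring

theorem rad_smooth : ContDiff ℝ (⊤ : ℕ∞) (fun x : ℝ × ℝ => wB √(x.1^2 + x.2^2)) := by
  rw [contDiff_iff_contDiffAt]
  intro x
  by_cases h : x.1^2 + x.2^2 = 0
  · have hc : ContinuousAt (fun x : ℝ × ℝ => √(x.1^2 + x.2^2)) x := by fun_prop
    have h1 : ∀ᶠ z in nhds x, √(z.1^2 + z.2^2) < 1/16 := by
      apply hc.eventually_lt continuousAt_const; rw [h]; norm_num
    refine (contDiffAt_const (c := (3/8 : ℝ))).congr_of_eventuallyEq ?_
    filter_upwards [h1] with z hz using wB_lo hz.le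
  · exact wB_smooth.contDiffAt.comp x (ContDiffAt.sqrt (by fun_prop) h)

theorem rad_deriv (p y : ℝ) : HasDerivAt (fun s => wB √(s^2 + y^2))
    (-(wW √(p^2 + y^2) * (p / √(p^2 + y^2)))) p := by
  by_cases h : p^2 + y^2 = 0
  · have hc : ContinuousAt (fun s : ℝ => √(s^2 + y^2)) p := by fun_prop
    have h1 : ∀ᶠ z in nhds p, √(z^2 + y^2) < 1/16 := by
      apply hc.eventually_lt continuousAt_const; rw [h]; norm_num
    rw [h]
    simp only [Real.sqrt_zero, div_zero, mul_zero, neg_zero]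
    refine (hasDerivAt_const p (3/8 : ℝ)).congr_of_eventuallyEq ?_
    filter_upwards [h1] with z hz using wB_lo hz.le
  · have h1 : HasDerivAt (fun s : ℝ => s^2 + y^2) (2 * p) p := by
      simpa using (hasDerivAt_pow 2 p).add_const (y^2)
    have h2 := (wB_deriv _).comp p (h1.sqrt h)
    exact hda h2 (fun z => rfl) (by ring)

/-- horizontal cutoff -/
def wU (p : ℝ) : ℝ := π/2 - sS (π/2 - sS (p - 2) - sS (-p - 2))
def wU' (p : ℝ) : ℝ := sG (π/2 - sS (p - 2) - sS (-p - 2)) * (sG (p - 2) - sG (-p - 2))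

theorem wU_deriv (p : ℝ) : HasDerivAt wU (wU' p) p := by
  have h1 : HasDerivAt (fun r : ℝ => r - 2) 1 p := (hasDerivAt_id p).sub_const _
  have h2 : HasDerivAt (fun r : ℝ => -r - 2) (-1) p := (hasDerivAt_id p).neg.sub_const _
  have h3 := (((sS_deriv _).comp p h1).const_sub (π/2)).sub ((sS_deriv _).comp p h2)
  have h4 := ((sS_deriv _).comp p h3).const_sub (π/2)
  exact hda h4 (fun z => rfl)
    (by simp only [wU']; simp only [Pi.sub_apply, Function.comp_apply]; ring)

theorem wU_smooth : ContDiff ℝ (⊤ : ℕ∞) wU :=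
  contDiff_const.sub (sS_smooth.comp ((contDiff_const.sub (sS_smooth.comp (by fun_prop))).sub
    (sS_smooth.comp (by fun_prop))))

theorem wU'_sq (p : ℝ) : wU' p ^ 2 ≤ 1 := by
  rw [sq_le_one_iff_abs_le_one]
  unfold wU'
  rw [abs_mul]
  refine mul_le_one₀ ?_ (abs_nonneg _) ?_
  · rw [abs_of_nonneg (sG_nonneg _)]; exact sG_le _
  · rw [abs_le]
    have := sG_nonneg (p - 2); have := sG_le (p - 2)
    have := sG_nonneg (-p - 2); have := sG_le (-p - 2)
    constructor <;> linarith

theorem wU_mid {p : ℝ} (h : |p| ≤ 1) : wU p = 0 := by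
  obtain ⟨h1, h2⟩ := abs_le.1 h
  unfold wU
  rw [sS_lo (t := p - 2) (by linarith), sS_lo (t := -p - 2) (by linarith),
    sS_hi (by linarith [Real.pi_gt_three])]
  ring

theorem wU_far {p : ℝ} (h : 5 ≤ |p|) : wU p = π/2 := by
  unfold wU
  have h3 := Real.pi_lt_four
  have := sS_nonneg (p - 2)
  have := sS_nonneg (-p - 2)
  rw [sS_lo (t := π/2 - sS (p - 2) - sS (-p - 2))]
  · ring
  rcases le_abs.1 h with h | h
  · rw [sS_hi (t := p - 2) (by linarith)]; linarith
  · rw [sS_hi (t := -p - 2) (by linarith)]; linarith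

theorem wTabs_smooth : ContDiff ℝ (⊤ : ℕ∞) (fun y : ℝ => wT |y|) := by
  rw [contDiff_iff_contDiffAt]
  intro y
  by_cases h : y = 0
  · refine (contDiffAt_const (c := (0 : ℝ))).congr_of_eventuallyEq ?_
    have : ∀ᶠ z in nhds y, |z| < 7/32 := by
      apply continuous_abs.continuousAt.eventually_lt continuousAt_const; simp [h]
    filter_upwards [this] with z hz using (w_lo hz.le).2.1
  · exact wT_smooth.contDiffAt.comp y (contDiffAt_abs h)

theorem wEabs_smooth : ContDiff ℝ (⊤ : ℕ∞) (fun y : ℝ => wE |y|) := by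
  rw [contDiff_iff_contDiffAt]
  intro y
  by_cases h : y = 0
  · refine (contDiffAt_const (c := (1 : ℝ))).congr_of_eventuallyEq ?_
    have : ∀ᶠ z in nhds y, |z| < 7/32 := by
      apply continuous_abs.continuousAt.eventually_lt continuousAt_const; simp [h]
    filter_upwards [this] with z hz using (w_lo hz.le).2.2.2.1
  rcases lt_or_ge |y| (1/2) with h' | h'
  · have h1 : ContDiffAt ℝ (⊤ : ℕ∞) wE |y| :=
      wS_smooth.contDiffAt.div (by fun_prop) (by linarith)
    exact h1.comp y (contDiffAt_abs h)
  · refine (contDiffAt_const (c := (0 : ℝ))).congr_of_eventuallyEq ?_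
    have : ∀ᶠ z in nhds y, 7/16 < |z| := by
      apply continuousAt_const.eventually_lt continuous_abs.continuousAt; linarith
    filter_upwards [this] with z hz using (w_hi hz.le).2.2.2.1

theorem wTabs_deriv {y : ℝ} (h0 : 0 ≤ y) : HasDerivAt (fun y : ℝ => wT |y|) (wT' y) y := by
  rcases h0.eq_or_lt with h | h
  · subst h
    rw [(w_lo (y := 0) (by norm_num)).2.2.1]
    refine (hasDerivAt_const (0:ℝ) (0 : ℝ)).congr_of_eventuallyEq ?_
    have : ∀ᶠ z in nhds (0:ℝ), |z| < 7/32 := by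
      apply continuous_abs.continuousAt.eventually_lt continuousAt_const; simp
    filter_upwards [this] with z hz using (w_lo hz.le).2.1
  · refine (wT_deriv y).congr_of_eventuallyEq ?_
    filter_upwards [lt_mem_nhds h] with z hz
    rw [abs_of_pos hz]

theorem wEabs_deriv {y : ℝ} (h0 : 0 ≤ y) : HasDerivAt (fun y : ℝ => wE |y|) (-wH y) y := by
  rcases h0.eq_or_lt with h | h
  · subst h
    rw [(w_lo (y := 0) (by norm_num)).2.2.2.2, neg_zero]
    refine (hasDerivAt_const (0:ℝ) (1 : ℝ)).congr_of_eventuallyEq ?_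
    have : ∀ᶠ z in nhds (0:ℝ), |z| < 7/32 := by
      apply continuous_abs.continuousAt.eventually_lt continuousAt_const; simp
    filter_upwards [this] with z hz using (w_lo hz.le).2.2.2.1
  rcases lt_or_ge y (1/2) with h' | h'
  · refine (wE_deriv h').congr_of_eventuallyEq ?_
    filter_upwards [lt_mem_nhds h] with z hz
    rw [abs_of_pos hz]
  · rw [(w_hi (y := y) (by linarith)).2.2.2.2, neg_zero]
    refine (hasDerivAt_const y (0 : ℝ)).congr_of_eventuallyEq ?_
    filter_upwards [lt_mem_nhds (show 7/16 < y by linarith)] with z hz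
    rw [abs_of_pos (by linarith)]
    exact (w_hi hz.le).2.2.2.1

/-- the stream function -/
def wPsi (x : ℝ × ℝ) : ℝ := cos (wU x.1) * wT |x.2| + wE |x.2| * wB √(x.1^2 + x.2^2)

theorem wPsi_smooth : ContDiff ℝ (⊤ : ℕ∞) wPsi :=
  ((Real.contDiff_cos.comp (wU_smooth.comp contDiff_fst)).mul (wTabs_smooth.comp contDiff_snd)).add
    ((wEabs_smooth.comp contDiff_snd).mul rad_smooth)

theorem wPsi_grad (p y : ℝ) (h0 : 0 ≤ y) : gradSq wPsi (p, y) =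
    (-(sin (wU p) * wU' p) * wT y - wE y * (wW √(p^2 + y^2) * (p / √(p^2 + y^2))))^2 +
    (cos (wU p) * wT' y - wH y * wB √(p^2 + y^2)
      - wE y * (wW √(p^2 + y^2) * (y / √(p^2 + y^2))))^2 := by
  have h1 : HasDerivAt (fun s => wPsi (s, y))
      (-(sin (wU p) * wU' p) * wT y - wE y * (wW √(p^2 + y^2) * (p / √(p^2 + y^2)))) p := by
    have := (((wU_deriv p).cos).mul_const (wT |y|)).add ((rad_deriv p y).const_mul (wE |y|))
    rw [abs_of_nonneg h0] at this
    refine hda this (fun s => ?_) ?_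
    · simp only [wPsi, abs_of_nonneg h0, Pi.add_apply]
    · ring
  have h2 : HasDerivAt (fun s => wPsi (p, s))
      (cos (wU p) * wT' y - wH y * wB √(p^2 + y^2)
      - wE y * (wW √(p^2 + y^2) * (y / √(p^2 + y^2)))) y := by
    have h3 := rad_deriv y p
    have := ((wTabs_deriv h0).const_mul (cos (wU p))).add ((wEabs_deriv h0).mul h3)
    rw [abs_of_nonneg h0, add_comm (y^2)] at this
    refine hda this (fun s => ?_) ?_
    · simp only [wPsi, Pi.add_apply, Pi.mul_apply, add_comm (s^2)]
    · ring
  unfold gradSq pd1 pd3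
  rw [h1.deriv, h2.deriv]

theorem wPsi_even (p y : ℝ) : wPsi (p, -y) = wPsi (p, y) := by simp [wPsi]

theorem gradSq_even (p y : ℝ) : gradSq wPsi (p, -y) = gradSq wPsi (p, y) := by
  unfold gradSq pd1 pd3
  simp only [wPsi_even]
  have h : (fun s => wPsi (p, s)) = fun s => wPsi (p, -s) := by simp only [wPsi_even]
  have : deriv (fun s => wPsi (p, s)) (-y) = -deriv (fun s => wPsi (p, s)) y := by
    conv_rhs => rw [h, deriv_comp_neg (fun s => wPsi (p, s)) y]
    simp
  rw [this]; ring

theorem gradSq_abs (p y : ℝ) : gradSq wPsi (p, y) = gradSq wPsi (p, |y|) := by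
  rcases abs_choice y with h | h
  · rw [h]
  · rw [h, gradSq_even]

theorem wU'_mid {p : ℝ} (h : |p| ≤ 9/16) : sin (wU p) = 0 ∧ cos (wU p) = 1 := by
  rw [wU_mid (by linarith)]; simp

theorem ineq_far {c s u t T : ℝ} (hcs : s^2 + c^2 = 1) (hu : u^2 ≤ 1) (h1 : t^2 ≤ 1)
    (h2 : T^2 ≤ 1) : (-(s * u) * T)^2 + (c * t)^2 ≤ 1 := by
  have h3 : u^2 * T^2 ≤ 1 := mul_le_one₀ hu (sq_nonneg _) h2
  nlinarith [mul_le_mul_of_nonneg_left h3 (sq_nonneg s), mul_le_mul_of_nonneg_left h1 (sq_nonneg c)]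

theorem ineq_near {e w a b X : ℝ} (he0 : 0 ≤ e) (he1 : e ≤ 1) (hw0 : 0 ≤ w) (hw1 : w ≤ 1)
    (hab : a^2 + b^2 ≤ 1) (hb : 0 ≤ b) (hlo : -(1 - e) - e * (w * b) ≤ X)
    (hup : X ≤ 0 ∨ (X ≤ 1/2 - e * (w * b) ∧ (w = 0 ∨ 7/17 ≤ b))) :
    (e * (w * a))^2 + X^2 ≤ 1 := by
  have hs0 : 0 ≤ e * w := mul_nonneg he0 hw0
  have hs1 : e * w ≤ e := mul_le_of_le_one_right he0 hw1
  have hb1 : b ≤ 1 := by nlinarith [sq_nonneg a]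
  rw [← mul_assoc] at *
  set s := e * w with hs
  have hq : (s * a)^2 ≤ s^2 * (1 - b^2) := by
    rw [mul_pow]; exact mul_le_mul_of_nonneg_left (by linarith) (sq_nonneg s)
  have main : X ≤ 0 → (s * a)^2 + X^2 ≤ 1 := by
    intro hX
    have h1 : X^2 ≤ ((1 - e) + s * b)^2 := by
      apply sq_le_sq'
      · linarith
      · nlinarith [mul_nonneg hs0 hb]
    have h2 : (1 - e) * s * b ≤ (1 - e) * s :=
      mul_le_of_le_one_right (mul_nonneg (by linarith) hs0) hb1
    have h3 : (1 - e + s)^2 ≤ 1 := by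
      rw [sq_le_one_iff_abs_le_one, abs_le]; constructor <;> linarith
    nlinarith
  rcases le_or_gt X 0 with hX | hX
  · exact main hX
  rcases hup with h | ⟨h, h'⟩
  · exact main h
  have h1 : X^2 ≤ (1/2 - s * b)^2 := pow_le_pow_left₀ hX.le h 2
  rcases h' with h' | h'
  · have : s = 0 := by rw [hs, h', mul_zero]
    rw [this] at h1 hq ⊢; nlinarith
  · nlinarith [mul_le_mul_of_nonneg_left h' hs0]

theorem wPsi_le (p y : ℝ) (h0 : 0 ≤ y) (hy : y ≤ 1/2) : gradSq wPsi (p, y) ≤ 1 := by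
  rw [wPsi_grad p y h0]
  have hyr : y ≤ √(p^2 + y^2) := Real.le_sqrt_of_sq_le (by nlinarith [sq_nonneg p])
  have hpr : |p| ≤ √(p^2 + y^2) := Real.abs_le_sqrt (by nlinarith [sq_nonneg y])
  have hr0 : 0 ≤ √(p^2 + y^2) := Real.sqrt_nonneg _
  have hr2 : √(p^2 + y^2)^2 = p^2 + y^2 := Real.sq_sqrt (by positivity)
  set r := √(p^2 + y^2) with hr
  obtain ⟨hT1, hT2⟩ := wT'_mem y
  obtain ⟨hT3, hT4⟩ := wT_mem h0 hy
  rcases le_or_gt (9/16) |p| with hp | hp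
  · obtain ⟨hb, hw⟩ := wB_hi (r := r) (by linarith)
    rw [hb, hw]
    have := ineq_far (sin_sq_add_cos_sq (wU p)) (wU'_sq p)
      (show wT' y ^ 2 ≤ 1 by nlinarith) (show wT y ^ 2 ≤ 1 by nlinarith)
    simpa using this
  · obtain ⟨hs, hc⟩ := wU'_mid hp.le
    rw [hs, hc]
    obtain ⟨he0, he1⟩ := wE_mem hy
    obtain ⟨hw0, hw1⟩ := wW_mem r
    have hh := wH_nonneg hy
    have hB := wB_nonneg r
    have hhB := mul_nonneg hh hB
    have hbr : 0 ≤ y / r := div_nonneg h0 hr0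
    have hewb : 0 ≤ wE y * (wW r * (y / r)) := mul_nonneg he0 (mul_nonneg hw0 hbr)
    have hD : 0 ≤ wH y * (1/2 - y) - wH y * wB r := by
      rw [← mul_sub]
      rcases le_or_gt y (7/32) with h | h
      · rw [(w_lo h).2.2.2.2]; simp
      rcases le_or_gt (7/16) y with h' | h'
      · rw [(w_hi h').2.2.2.2]; simp
      refine mul_nonneg hh ?_
      have h1 := wB_anti hyr
      rw [(wB_mid (r := y) (by linarith) (by linarith)).1] at h1
      linarith
    have key := ineq_near (a := p / r) (b := y / r)
      (X := 1 * wT' y - wH y * wB r - wE y * (wW r * (y / r))) he0 he1 hw0 hw1 ?_ hbr ?_ ?_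
    · simpa using key
    · rw [div_pow, div_pow, ← add_div, ← hr2]; exact div_self_le_one _
    · rw [wT'_eq hy]; linarith
    · rcases le_or_gt y (7/32) with h | h
      · left; rw [(w_lo h).2.2.1]; linarith
      · right
        refine ⟨by linarith, ?_⟩
        rcases le_or_gt (17/32) r with h' | h'
        · left; exact (wB_hi h').2
        · right; rw [le_div_iff₀ (by linarith)]; linarith

theorem wPsi_circle (p y : ℝ) (h0 : 0 ≤ y) (hy : y ≤ 3/16) (hp : p^2 + y^2 = (3/16)^2) :
    gradSq wPsi (p, y) = 1 := by
  rw [wPsi_grad p y h0, hp, Real.sqrt_sq (by norm_num)]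
  obtain ⟨-, h1, h2, h3, h4⟩ := w_lo (y := y) (by linarith)
  obtain ⟨h5, h6⟩ := wB_mid (r := 3/16) le_rfl (by norm_num)
  rw [h1, h2, h3, h4, h6]
  nlinarith

theorem wPsi_vert (y : ℝ) (h0 : 3/16 ≤ y) (hy : y ≤ 1/2) : gradSq wPsi (0, y) = 1 := by
  rw [wPsi_grad 0 y (by linarith)]
  have hr : √((0:ℝ)^2 + y^2) = y := by
    rw [zero_pow two_ne_zero, zero_add, Real.sqrt_sq (by linarith)]
  obtain ⟨hs, hc⟩ := wU'_mid (p := 0) (by norm_num)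
  rw [hr, hs, hc, div_self (by linarith), wT'_eq hy]
  rcases le_or_gt (7/16) y with h | h
  · obtain ⟨-, -, -, h2, h3⟩ := w_hi h
    rw [h2, h3]; ring
  · obtain ⟨h5, h6⟩ := wB_mid (r := y) h0 (by linarith)
    rw [h5, h6]; ring

/-- Stream function construction for the Asymmetric Bloch wall: a smooth `ψ` with
`|∇ψ|² ≤ 1`, vanishing on the boundary lines and for large `|x₁|`, such that `|∇ψ|² = 1`
along a continuous curve joining `(0,−1/2)` to `(0,1/2)` inside the closed strip. -/
theorem stream_function_construction :
    ∃ ψ : ℝ × ℝ → ℝ,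
      ContDiff ℝ (⊤ : ℕ∞) ψ ∧
      (∀ x ∈ ClosedStrip, gradSq ψ x ≤ 1) ∧
      (∀ x : ℝ × ℝ, (x.2 = 1/2 ∨ x.2 = -(1/2)) → ψ x = 0) ∧
      (∃ R : ℝ, ∀ x ∈ ClosedStrip, R ≤ |x.1| → ψ x = 0) ∧
      ∃ γ : ℝ → ℝ × ℝ, ContinuousOn γ (Set.Icc 0 1) ∧
        γ 0 = (0, -(1/2)) ∧ γ 1 = (0, 1/2) ∧
        ∀ s ∈ Set.Icc (0:ℝ) 1, γ s ∈ ClosedStrip ∧ gradSq ψ (γ s) = 1 := by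
  refine ⟨wPsi, wPsi_smooth, ?_, ?_, ⟨5, ?_⟩,
    fun s => (√((3/16)^2 - (s - 1/2)^2), s - 1/2), ?_, ?_, ?_, ?_⟩
  · rintro ⟨p, y⟩ ⟨-, hy⟩
    rw [gradSq_abs]
    exact wPsi_le _ _ (abs_nonneg _) (abs_le.2 hy)
  · rintro ⟨p, y⟩ hy
    have h : |y| = 1/2 := by
      rcases hy with h | h <;> · simp only at h; rw [h]; norm_num
    obtain ⟨-, h1, -, h2, -⟩ := w_hi (y := |y|) (by rw [h]; norm_num)
    simp only [wPsi]
    rw [h1, h2, h]; ring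
  · rintro ⟨p, y⟩ - hp
    have hpr : |p| ≤ √(p^2 + y^2) := Real.abs_le_sqrt (by nlinarith [sq_nonneg y])
    simp only at hp
    simp only [wPsi]
    rw [wU_far hp, (wB_hi (by linarith)).1]; simp
  · exact Continuous.continuousOn (by fun_prop)
  · ext
    · exact Real.sqrt_eq_zero_of_nonpos (by norm_num)
    · norm_num
  · ext
    · exact Real.sqrt_eq_zero_of_nonpos (by norm_num)
    · norm_num
  · rintro s ⟨hs0, hs1⟩
    have hy : |s - 1/2| ≤ 1/2 := abs_le.2 ⟨by linarith, by linarith⟩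
    refine ⟨⟨trivial, abs_le.1 hy⟩, ?_⟩
    rw [gradSq_abs]
    rcases le_or_gt |s - 1/2| (3/16) with h | h
    · have h2 : (s - 1/2)^2 ≤ (3/16)^2 := by
        rw [← sq_abs]; exact pow_le_pow_left₀ (abs_nonneg _) h 2
      refine wPsi_circle _ _ (abs_nonneg _) h ?_
      rw [Real.sq_sqrt (by linarith), sq_abs]; ring
    · have h2 : (3/16)^2 ≤ (s - 1/2)^2 := by
        rw [← sq_abs (s - 1/2)]; exact pow_le_pow_left₀ (by norm_num) h.le 2
      rw [Real.sqrt_eq_zero_of_nonpos (by linarith)]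
      exact wPsi_vert _ h.le hy

end
end

section
/- Logarithmic profile estimate for the Néel wall: there exist universal constants C₀ ≥ 2 and C > 0 with the following property. Let t, d > 0 and Q > 0 satisfy t²/(Q d²) ≥ C₀, and define U : ℝ² → ℝ by U(x) = (ln(Q d²/t²))⁻¹ · ln √( min{ (Q|x|/t)² + (Q d²/t²)², 1 } ), and m₁(x₁) = U(x₁, 0). Then 0 ≤ m₁ ≤ 1, m₁(0) = 1, and (d²/t)·∫_ℝ (1 − m₁²)⁻¹ (dm₁/dx₁)² dx₁ + (Q/t)·∫_ℝ m₁² dx₁ + ∫_{ℝ²} |∇U|² d²x ≤ C / ln(t²/(Q d²)). -/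
open MeasureTheory Real Set Filter
open scoped ENNReal

noncomputable section

/-- the one-dimensional profile -/
def prof (L a c : ℝ) (s : ℝ) : ℝ := (1/(2*L)) * (-Real.log (min (a^2*s^2 + c) 1))

lemma prof_nonneg {L a c : ℝ} (hL : 0 < L) (hc : 0 < c) (s : ℝ) : 0 ≤ prof L a c s := by
  unfold prof
  have h0 : 0 < min (a^2*s^2 + c) 1 := lt_min (by positivity) one_pos
  have := Real.log_nonpos h0.le (min_le_right _ _)
  have : 0 ≤ -Real.log (min (a^2*s^2 + c) 1) := by linarith
  positivity

lemma prof_zero {L a c : ℝ} (s : ℝ) (h : 1 ≤ a^2*s^2 + c) : prof L a c s = 0 := by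
  unfold prof
  rw [min_eq_right h]; simp

lemma deriv_prof_zero {L a c : ℝ} (hL : 0 < L) (hc : 0 < c) (s : ℝ) (h : 1 ≤ a^2*s^2 + c) :
    deriv (prof L a c) s = 0 := by
  apply IsLocalMin.deriv_eq_zero
  apply Filter.Eventually.of_forall
  intro y
  rw [prof_zero s h]
  exact prof_nonneg hL hc y

lemma deriv_prof {L a c : ℝ} (hL : 0 < L) (hc : 0 < c) (s : ℝ) (h : a^2*s^2 + c < 1) :
    deriv (prof L a c) s = -(a^2*s/(L*(a^2*s^2+c))) := by
  have hpos : 0 < a^2*s^2 + c := by positivity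
  have hev : prof L a c =ᶠ[nhds s] fun s => (1/(2*L)) * (-Real.log (a^2*s^2 + c)) := by
    have : ∀ᶠ y in nhds s, a^2*y^2 + c < 1 :=
      (show Continuous fun y : ℝ => a^2*y^2 + c by fun_prop).continuousAt.eventually_lt
        continuousAt_const h
    filter_upwards [this] with y hy
    unfold prof
    rw [min_eq_left hy.le]
  rw [hev.deriv_eq]
  have h1 : HasDerivAt (fun s : ℝ => a^2*s^2 + c) (a^2*(2*s)) s := by
    simpa using ((hasDerivAt_pow 2 s).const_mul (a^2)).add_const c
  have h2 := ((h1.log hpos.ne').neg.const_mul (1/(2*L)))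
  refine h2.deriv.trans ?_
  field_simp

lemma term1_pt {L a e : ℝ} (hL : 0 < L) (ha : 0 < a) (he : 0 < e) (hLe : Real.log e = -L)
    (s : ℝ) : (1 - (prof L a (e^2) s)^2)⁻¹ * (deriv (prof L a (e^2)) s)^2
      ≤ (2/L) * (a/e)^2 * (1 + ((a/e)*s)^2)⁻¹ := by
  have hr : 0 ≤ (2/L) * (a/e)^2 * (1 + ((a/e)*s)^2)⁻¹ := by positivity
  have hc : 0 < e^2 := by positivity
  rcases le_or_gt 1 (a^2*s^2 + e^2) with h | h
  · rw [deriv_prof_zero hL hc s h]; simpa using hr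
  rcases eq_or_ne s 0 with rfl | hs
  · rw [deriv_prof hL hc 0 h]; simpa using hr
  have hs2 : 0 < s^2 := by positivity
  have hp := prof_nonneg (a := a) hL hc s
  rw [deriv_prof hL hc s h]
  have hy : 0 < a^2*s^2 + e^2 := by positivity
  have hm : prof L a (e^2) s = (1/(2*L)) * (-Real.log (a^2*s^2 + e^2)) := by
    unfold prof; rw [min_eq_left h.le]
  have hlog : 1 - ((a^2*s^2+e^2)/e^2)⁻¹ ≤ Real.log ((a^2*s^2+e^2)/e^2) :=
    Real.one_sub_inv_le_log_of_pos (by positivity)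
  rw [Real.log_div hy.ne' hc.ne', Real.log_pow, hLe] at hlog
  have hq : 1 - ((a^2*s^2+e^2)/e^2)⁻¹ = a^2*s^2/(a^2*s^2+e^2) := by field_simp; ring
  rw [hq] at hlog
  push_cast at hlog
  have h1 : 1 - prof L a (e^2) s = (1/(2*L)) * (Real.log (a^2*s^2 + e^2) + 2*L) := by
    rw [hm]; field_simp; ring
  have h2 : (1/(2*L)) * (a^2*s^2/(a^2*s^2+e^2)) ≤ 1 - prof L a (e^2) s := by
    rw [h1]
    apply mul_le_mul_of_nonneg_left _ (by positivity)
    linarith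
  have h3 : 0 < (1/(2*L)) * (a^2*s^2/(a^2*s^2+e^2)) := by positivity
  have h4 : (1/(2*L)) * (a^2*s^2/(a^2*s^2+e^2)) ≤ 1 - (prof L a (e^2) s)^2 := by nlinarith
  have h5 := inv_anti₀ h3 h4
  calc _ ≤ ((1/(2*L)) * (a^2*s^2/(a^2*s^2+e^2)))⁻¹ * (-(a^2*s/(L*(a^2*s^2+e^2))))^2 :=
        mul_le_mul_of_nonneg_right h5 (sq_nonneg _)
    _ = _ := by
        have : e^2 + a^2*s^2 ≠ 0 := by positivity
        field_simp
        ring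

lemma term1 {L a e b : ℝ} (hL : 0 < L) (ha : 0 < a) (he : 0 < e) (hLe : Real.log e = -L)
    (hb : b = a/e) :
    ENNReal.ofReal (1/b) * (∫⁻ s, ENNReal.ofReal
      ((1 - (prof L a (e^2) s)^2)⁻¹ * (deriv (prof L a (e^2)) s)^2)) ≤ ENNReal.ofReal (2*π/L) := by
  have hb0 : 0 < b := by rw [hb]; positivity
  have hint : Integrable (fun s : ℝ => (2/L) * b^2 * (1 + (b*s)^2)⁻¹) :=
    (integrable_inv_one_add_sq.comp_mul_left' hb0.ne').const_mul _
  have hval : ∫ s : ℝ, (2/L) * b^2 * (1 + (b*s)^2)⁻¹ = b * (2*π/L) := by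
    rw [integral_const_mul, Measure.integral_comp_mul_left (fun x : ℝ => (1 + x^2)⁻¹) b,
      integral_univ_inv_one_add_sq, abs_of_pos (by positivity)]
    simp only [smul_eq_mul]
    field_simp
  calc _ ≤ ENNReal.ofReal (1/b) * ∫⁻ s, ENNReal.ofReal ((2/L) * b^2 * (1 + (b*s)^2)⁻¹) := by
        refine mul_le_mul_right (lintegral_mono fun s => ENNReal.ofReal_le_ofReal ?_) _
        rw [hb]
        exact term1_pt hL ha he hLe s
    _ = _ := by
        rw [← ofReal_integral_eq_lintegral_ofReal hint
          (Filter.Eventually.of_forall fun s => by positivity), hval,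
          ← ENNReal.ofReal_mul (by positivity)]
        congr 1
        field_simp

lemma prof_le_one {L a e : ℝ} (hL : 0 < L) (he : 0 < e) (he1 : e < 1)
    (hLe : Real.log e = -L) (s : ℝ) : prof L a (e^2) s ≤ 1 := by
  unfold prof
  have h : e^2 ≤ min (a^2*s^2 + e^2) 1 := by
    apply le_min
    · nlinarith [mul_nonneg (sq_nonneg a) (sq_nonneg s)]
    · nlinarith
  have := Real.log_le_log (by positivity) h
  rw [Real.log_pow, hLe] at this
  push_cast at this
  rw [one_div, inv_mul_le_iff₀ (by positivity)]
  linarith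

lemma term2_pt {L a e : ℝ} (hL : 0 < L) (ha : 0 < a) (he : 0 < e) (he1 : e < 1)
    (hLe : Real.log e = -L) (s : ℝ) (hs : s ≠ 0) :
    ENNReal.ofReal ((prof L a (e^2) s)^2) ≤
      (Ioc (-a⁻¹) a⁻¹).indicator (fun s => ENNReal.ofReal ((1/L) * (-Real.log (a*s)))) s := by
  have hc : 0 < e^2 := by positivity
  rcases le_or_gt 1 (a^2*s^2 + e^2) with h | h
  · rw [prof_zero s h]; simp
  have habs : |a*s| < 1 := by
    rw [← sq_lt_one_iff_abs_lt_one]; nlinarith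
  have hmem : s ∈ Ioc (-a⁻¹) a⁻¹ := by
    rw [abs_lt] at habs
    constructor
    · rw [neg_lt, inv_eq_one_div, lt_div_iff₀ ha]; nlinarith
    · rw [inv_eq_one_div, le_div_iff₀ ha]; nlinarith
  rw [indicator_of_mem hmem]
  apply ENNReal.ofReal_le_ofReal
  have h0 := prof_nonneg (a := a) hL hc s
  have h1 := prof_le_one (a := a) hL he he1 hLe s
  have h2 : (prof L a (e^2) s)^2 ≤ prof L a (e^2) s := by nlinarith
  refine h2.trans ?_
  unfold prof
  rw [min_eq_left h.le]
  have hs2 : 0 < (a*s)^2 := by positivity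
  have h3 : Real.log ((a*s)^2) ≤ Real.log (a^2*s^2+e^2) :=
    Real.log_le_log hs2 (by nlinarith)
  rw [Real.log_pow] at h3
  push_cast at h3
  have : (1/L) * (-Real.log (a*s)) = (1/(2*L)) * (-(2*Real.log (a*s))) := by field_simp
  rw [this]
  apply mul_le_mul_of_nonneg_left _ (by positivity)
  linarith

lemma term2 {L a e : ℝ} (hL : 0 < L) (ha : 0 < a) (he : 0 < e) (he1 : e < 1)
    (hLe : Real.log e = -L) :
    ENNReal.ofReal a * (∫⁻ s, ENNReal.ofReal ((prof L a (e^2) s)^2)) ≤ ENNReal.ofReal (2/L) := by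
  have ha' : 0 < a⁻¹ := by positivity
  have hae : ∀ᵐ s : ℝ, s ≠ 0 := by simp [ae_iff]
  have hii : IntervalIntegrable (fun s => (1/L) * (-Real.log (a*s))) volume (-a⁻¹) a⁻¹ := by
    apply IntervalIntegrable.const_mul
    apply IntervalIntegrable.neg
    have := (intervalIntegral.intervalIntegrable_log' (a := -1) (b := 1)).comp_mul_left (c := a)
    simpa [neg_div] using this
  have hint : IntegrableOn (fun s => (1/L) * (-Real.log (a*s))) (Ioc (-a⁻¹) a⁻¹) :=
    (intervalIntegrable_iff_integrableOn_Ioc_of_le (by linarith)).1 hii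
  have hval : ∫ s in Ioc (-a⁻¹) a⁻¹, (1/L) * (-Real.log (a*s)) = a⁻¹ * (2/L) := by
    rw [← intervalIntegral.integral_of_le (by linarith), intervalIntegral.integral_const_mul,
      intervalIntegral.integral_neg, intervalIntegral.integral_comp_mul_left _ ha.ne', integral_log]
    rw [mul_neg, mul_inv_cancel₀ ha.ne']
    simp only [Real.log_one, Real.log_neg_eq_log, smul_eq_mul]
    field_simp
    norm_num
  have hnn : 0 ≤ᵐ[volume.restrict (Ioc (-a⁻¹) a⁻¹)] fun s => (1/L) * (-Real.log (a*s)) := by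
    filter_upwards [ae_restrict_mem measurableSet_Ioc] with s hs
    have : |a*s| ≤ 1 := by
      rw [abs_le]
      have h1 := mul_le_mul_of_nonneg_left hs.1.le ha.le
      have h2 := mul_le_mul_of_nonneg_left hs.2 ha.le
      rw [mul_neg, mul_inv_cancel₀ ha.ne'] at h1
      rw [mul_inv_cancel₀ ha.ne'] at h2
      exact ⟨h1, h2⟩
    have h4 : Real.log (a*s) ≤ 0 := by
      rw [← Real.log_abs]; exact Real.log_nonpos (abs_nonneg _) this
    have : 0 ≤ -Real.log (a*s) := by linarith
    simp only [Pi.zero_apply]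
    positivity
  calc _ ≤ ENNReal.ofReal a * ∫⁻ s,
        (Ioc (-a⁻¹) a⁻¹).indicator (fun s => ENNReal.ofReal ((1/L) * (-Real.log (a*s)))) s := by
        refine mul_le_mul_right (lintegral_mono_ae ?_) _
        filter_upwards [hae] with s hs
        exact term2_pt hL ha he he1 hLe s hs
    _ = _ := by
        rw [lintegral_indicator measurableSet_Ioc, ← ofReal_integral_eq_lintegral_ofReal hint hnn,
          hval, ← ENNReal.ofReal_mul ha.le]
        congr 1
        field_simp

/-- radial bound -/
def radB (L a e : ℝ) (r : ℝ) : ℝ≥0∞ :=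
  (Iio (a⁻¹)).indicator (fun r => ENNReal.ofReal ((1/L^2) * (a^2/(a^2*r^2+e^2)))) r

lemma term3_pt {L a e : ℝ} (hL : 0 < L) (ha : 0 < a) (he : 0 < e) (U : ℝ × ℝ → ℝ)
    (hU : ∀ x : ℝ × ℝ, U x = (1/(2*L)) * (-Real.log (min (a^2*(x.1^2+x.2^2) + e^2) 1)))
    (x : ℝ × ℝ) : ENNReal.ofReal (gradSq U x) ≤ radB L a e (Real.sqrt (x.1^2+x.2^2)) := by
  have hc1 : 0 < a^2*x.2^2 + e^2 := by positivity
  have hc3 : 0 < a^2*x.1^2 + e^2 := by positivity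
  have e1 : pd1 U x = deriv (prof L a (a^2*x.2^2 + e^2)) x.1 := by
    unfold pd1; congr 1; ext s; rw [hU]; unfold prof; ring_nf
  have e3 : pd3 U x = deriv (prof L a (a^2*x.1^2 + e^2)) x.2 := by
    unfold pd3; congr 1; ext s; rw [hU]; unfold prof; ring_nf
  unfold gradSq
  rw [e1, e3]
  rcases le_or_gt 1 (a^2*(x.1^2+x.2^2) + e^2) with h | h
  · rw [deriv_prof_zero hL hc1 _ (by linarith), deriv_prof_zero hL hc3 _ (by linarith)]; simp
  rw [deriv_prof hL hc1 _ (by linarith), deriv_prof hL hc3 _ (by linarith)]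
  have hn : 0 ≤ x.1^2+x.2^2 := by positivity
  have hmem : Real.sqrt (x.1^2+x.2^2) ∈ Iio (a⁻¹) := by
    rw [mem_Iio, Real.sqrt_lt' (by positivity), inv_pow, inv_eq_one_div, lt_div_iff₀ (by positivity)]
    nlinarith [sq_pos_of_pos he]
  unfold radB
  rw [indicator_of_mem hmem, Real.sq_sqrt hn]
  apply ENNReal.ofReal_le_ofReal
  have hD : 0 < a^2*(x.1^2+x.2^2) + e^2 := by positivity
  have q1 : a^2*x.1^2 + (a^2*x.2^2 + e^2) = a^2*(x.1^2+x.2^2) + e^2 := by ring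
  have q3 : a^2*x.2^2 + (a^2*x.1^2 + e^2) = a^2*(x.1^2+x.2^2) + e^2 := by ring
  rw [q1, q3]
  set D := a^2*(x.1^2+x.2^2) + e^2 with hDD
  have : (-(a^2*x.1/(L*D)))^2 + (-(a^2*x.2/(L*D)))^2
      = (1/L^2) * (a^2/D) * ((D - e^2)/D) := by
    rw [hDD] at hD ⊢
    field_simp
    ring
  rw [this]
  have h1 : (D - e^2)/D ≤ 1 := by
    rw [div_le_one hD]; nlinarith
  have h2 : 0 ≤ (1/L^2) * (a^2/D) := by positivity
  calc _ ≤ (1/L^2) * (a^2/D) * 1 := mul_le_mul_of_nonneg_left h1 h2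
    _ ≤ _ := by apply le_of_eq; ring

lemma radB_int {L a e : ℝ} (hL : 0 < L) (ha : 0 < a) (he : 0 < e) (he1 : e < 1)
    (hLe : Real.log e = -L) (hL2 : Real.log 2 ≤ L) :
    ∫⁻ r in Ioi (0:ℝ), ENNReal.ofReal r * radB L a e r ≤ ENNReal.ofReal (3/(2*L)) := by
  have ha' : 0 < a⁻¹ := by positivity
  let F : ℝ → ℝ := fun r => (1/(2*L^2)) * Real.log (a^2*r^2+e^2)
  let f : ℝ → ℝ := fun r => r * ((1/L^2) * (a^2/(a^2*r^2+e^2)))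
  have hpos : ∀ r : ℝ, 0 < a^2*r^2+e^2 := fun r => by positivity
  have hcont : Continuous f := by
    have : ∀ r : ℝ, a^2*r^2+e^2 ≠ 0 := fun r => (hpos r).ne'
    fun_prop (disch := exact this _)
  have hder : ∀ r, HasDerivAt F (f r) r := by
    intro r
    have h1 : HasDerivAt (fun s : ℝ => a^2*s^2 + e^2) (a^2*(2*r)) r := by
      simpa using ((hasDerivAt_pow 2 r).const_mul (a^2)).add_const (e^2)
    have h2 := ((h1.log (hpos r).ne').const_mul (1/(2*L^2)))
    have h3 : f r = (1/(2*L^2)) * (a^2*(2*r)/(a^2*r^2+e^2)) := by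
      have := hpos r
      simp only [f]
      field_simp
    rw [h3]
    exact h2
  have hval : ∫ r in Ioc 0 a⁻¹, f r = F a⁻¹ - F 0 := by
    rw [← intervalIntegral.integral_of_le ha'.le]
    exact intervalIntegral.integral_eq_sub_of_hasDerivAt (fun r _ => hder r)
      (hcont.intervalIntegrable _ _)
  have hint : IntegrableOn f (Ioc 0 a⁻¹) :=
    (intervalIntegrable_iff_integrableOn_Ioc_of_le ha'.le).1 (hcont.intervalIntegrable _ _)
  calc _ ≤ ∫⁻ r in Ioi (0:ℝ), (Ioc 0 a⁻¹).indicator (fun r => ENNReal.ofReal (f r)) r := by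
        apply lintegral_mono_ae
        filter_upwards [ae_restrict_mem measurableSet_Ioi] with r hr
        unfold radB
        by_cases h : r ∈ Iio a⁻¹
        · have hm : r ∈ Ioc 0 a⁻¹ := ⟨hr, le_of_lt h⟩
          rw [indicator_of_mem h, indicator_of_mem hm, ← ENNReal.ofReal_mul (le_of_lt hr)]
        · rw [indicator_of_notMem h]; simp
    _ ≤ ∫⁻ r, (Ioc 0 a⁻¹).indicator (fun r => ENNReal.ofReal (f r)) r :=
        setLIntegral_le_lintegral _ _
    _ = ENNReal.ofReal (F a⁻¹ - F 0) := by
        rw [lintegral_indicator measurableSet_Ioc, ← ofReal_integral_eq_lintegral_ofReal hint ?_, hval]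
        filter_upwards [ae_restrict_mem measurableSet_Ioc] with r hr
        have := hr.1
        simp only [Pi.zero_apply, f]
        positivity
    _ ≤ _ := by
        apply ENNReal.ofReal_le_ofReal
        simp only [F]
        have h1 : a^2*(a⁻¹)^2 + e^2 = 1 + e^2 := by field_simp
        have h2 : Real.log (1+e^2) ≤ Real.log 2 :=
          Real.log_le_log (by positivity) (by nlinarith)
        have h3 : a^2*0^2 + e^2 = e^2 := by ring
        rw [h1, h3, Real.log_pow, hLe, ← mul_sub]
        push_cast
        calc _ ≤ (1/(2*L^2)) * (3*L) := by
              apply mul_le_mul_of_nonneg_left _ (by positivity)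
              linarith
          _ = _ := by field_simp

lemma term3 {L a e : ℝ} (hL : 0 < L) (ha : 0 < a) (he : 0 < e) (he1 : e < 1)
    (hLe : Real.log e = -L) (hL2 : Real.log 2 ≤ L) (U : ℝ × ℝ → ℝ)
    (hU : ∀ x : ℝ × ℝ, U x = (1/(2*L)) * (-Real.log (min (a^2*(x.1^2+x.2^2) + e^2) 1))) :
    ∫⁻ x, ENNReal.ofReal (gradSq U x) ≤ ENNReal.ofReal (3*π/L) := by
  have hm : Measurable (radB L a e) := by
    unfold radB
    apply Measurable.indicator _ measurableSet_Iio
    fun_prop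
  calc _ ≤ ∫⁻ x : ℝ × ℝ, radB L a e (Real.sqrt (x.1^2+x.2^2)) :=
        lintegral_mono (term3_pt hL ha he U hU)
    _ = ∫⁻ p in Ioi (0:ℝ) ×ˢ Ioo (-π) π, ENNReal.ofReal p.1 * radB L a e p.1 := by
        rw [← lintegral_comp_polarCoord_symm]
        apply setLIntegral_congr_fun polarCoord.open_target.measurableSet
        intro p hp
        have hp1 : 0 < p.1 := hp.1
        simp only [polarCoord_symm_apply, smul_eq_mul]
        congr 2
        rw [show (p.1 * Real.cos p.2)^2 + (p.1 * Real.sin p.2)^2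
          = p.1^2 * (Real.sin p.2 ^ 2 + Real.cos p.2 ^ 2) by ring, Real.sin_sq_add_cos_sq, mul_one,
          Real.sqrt_sq hp1.le]
    _ = (∫⁻ r in Ioi (0:ℝ), ENNReal.ofReal r * radB L a e r) * ENNReal.ofReal (2*π) := by
        rw [Measure.volume_eq_prod, ← Measure.prod_restrict, lintegral_prod _ (by fun_prop)]
        simp only [lintegral_const]
        rw [lintegral_mul_const _ (by fun_prop)]
        congr 1
        rw [Measure.restrict_apply_univ, Real.volume_Ioo]
        congr 1
        ring
    _ ≤ ENNReal.ofReal (3/(2*L)) * ENNReal.ofReal (2*π) := by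
        gcongr
        exact radB_int hL ha he he1 hLe hL2
    _ = _ := by
        rw [← ENNReal.ofReal_mul (by positivity)]
        congr 1
        field_simp

/-- Logarithmic profile estimate for the Néel wall construction. -/
theorem neel_profile_estimate :
    ∃ C0 C : ℝ, 2 ≤ C0 ∧ 0 < C ∧
      ∀ t d Q : ℝ, 0 < t → 0 < d → 0 < Q → C0 ≤ t^2/(Q*d^2) →
        ∀ (U : ℝ × ℝ → ℝ) (m1 : ℝ → ℝ),
          (∀ x : ℝ × ℝ, U x = (Real.log (Q*d^2/t^2))⁻¹ *
              Real.log (Real.sqrt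
                (min ((Q * Real.sqrt (x.1^2 + x.2^2) / t)^2 + (Q*d^2/t^2)^2) 1))) →
          (∀ x1 : ℝ, m1 x1 = U (x1, 0)) →
          (∀ x1 : ℝ, m1 x1 ∈ Set.Icc (0:ℝ) 1) ∧ m1 0 = 1 ∧
          ENNReal.ofReal (d^2/t) *
              (∫⁻ x1 : ℝ, ENNReal.ofReal ((1 - (m1 x1)^2)⁻¹ * (deriv m1 x1)^2))
            + ENNReal.ofReal (Q/t) * (∫⁻ x1 : ℝ, ENNReal.ofReal ((m1 x1)^2))
            + (∫⁻ x : ℝ × ℝ, ENNReal.ofReal (gradSq U x))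
            ≤ ENNReal.ofReal (C / Real.log (t^2/(Q*d^2))) := by
  refine ⟨2, 5*π + 2, le_refl _, by positivity, ?_⟩
  intro t d Q ht hd hQ hC U m1 hU hm
  have he0 : 0 < Q*d^2/t^2 := by positivity
  have hinv : t^2/(Q*d^2) = (Q*d^2/t^2)⁻¹ := by rw [inv_div]
  have hlogL : Real.log (Q*d^2/t^2) = -Real.log (t^2/(Q*d^2)) := by
    rw [hinv, Real.log_inv, neg_neg]
  have hL2 : Real.log 2 ≤ Real.log (t^2/(Q*d^2)) := Real.log_le_log (by norm_num) hC
  have hL : 0 < Real.log (t^2/(Q*d^2)) := lt_of_lt_of_le (Real.log_pos (by norm_num)) hL2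
  have he1 : Q*d^2/t^2 < 1 := by
    by_contra hh
    have := Real.log_nonneg (not_lt.1 hh)
    linarith
  have hb : 1/(d^2/t) = (Q/t)/(Q*d^2/t^2) := by field_simp
  have hb' : d^2/t = 1/(1/(d^2/t)) := by field_simp
  set L := Real.log (t^2/(Q*d^2)) with hLdef
  set e := Q*d^2/t^2 with hedef
  set a := Q/t with hadef
  have ha : 0 < a := by positivity
  have hU' : ∀ x : ℝ × ℝ, U x = (1/(2*L)) * (-Real.log (min (a^2*(x.1^2+x.2^2) + e^2) 1)) := by
    intro x
    have hq : (Q * Real.sqrt (x.1^2 + x.2^2) / t)^2 = a^2*(x.1^2+x.2^2) := by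
      rw [hadef, div_pow, mul_pow, Real.sq_sqrt (by positivity)]; ring
    rw [hU, hq, Real.log_sqrt (le_min (by positivity) zero_le_one), hlogL]
    field_simp
  have hm' : m1 = prof L a (e^2) := by
    ext s
    rw [hm, hU']; unfold prof; simp
  have hc : 0 < e^2 := by positivity
  subst hm'
  refine ⟨fun s => ⟨prof_nonneg hL hc s, prof_le_one hL he0 he1 hlogL s⟩, ?_, ?_⟩
  · unfold prof
    rw [min_eq_left (by nlinarith)]
    simp only [ne_eq, OfNat.ofNat_ne_zero, not_false_eq_true, zero_pow, mul_zero, zero_add]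
    rw [Real.log_pow, hlogL]
    push_cast
    field_simp
  · have t1 := term1 hL ha he0 hlogL hb
    rw [← hb'] at t1
    have t2 := term2 hL ha he0 he1 hlogL
    have t3 := term3 hL ha he0 he1 hlogL hL2 U hU'
    refine (add_le_add (add_le_add t1 t2) t3).trans ?_
    rw [← ENNReal.ofReal_add (by positivity) (by positivity),
      ← ENNReal.ofReal_add (by positivity) (by positivity)]
    apply ENNReal.ofReal_le_ofReal
    apply le_of_eq
    field_simp
    ring

end
end

section
/- H^{1/2}-seminorm bound for the trapezoidal test function: there is a universal constant C > 0 such that for all real numbers ρ, ℓ with 0 < ρ ≤ ℓ/2 and all ξ̃₁ ≤ ξ₁ with ξ₁ − ξ̃₁ ≤ ℓ, the function ζ : ℝ → ℝ defined by ζ(x₁) = 0 for x₁ ≥ ξ₁ + ρ, ζ(x₁) = (ξ₁ − x₁ + ρ)/ρ for ξ₁ ≤ x₁ ≤ ξ₁ + ρ, ζ(x₁) = 1 for ξ̃₁ ≤ x₁ ≤ ξ₁, ζ(x₁) = (x₁ − ξ̃₁ + ρ)/ρ for ξ̃₁ − ρ ≤ x₁ ≤ ξ̃₁, and ζ(x₁)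 = 0 for x₁ ≤ ξ̃₁ − ρ, satisfies ∫_0^∞ (1/x₃²) ∫_{−∞}^{∞} ( ζ(x₁ + x₃) − ζ(x₁) )² dx₁ dx₃ ≤ C·(1 + ln(ℓ/ρ)). -/
open MeasureTheory Real Set Filter
open scoped ENNReal

noncomputable section

theorem aux_lint (f : ℝ → ℝ) (c a b a' b' : ℝ) (hc : 0 ≤ c) (hab : a ≤ b) (hab' : a' ≤ b')
    (h1 : ∀ x, f x ≤ c)
    (h2 : ∀ x, x ∉ Icc a b ∪ Icc a' b' → f x = 0) :
    ∫⁻ x, ENNReal.ofReal (f x) ≤ ENNReal.ofReal (c * ((b - a) + (b' - a'))) := by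
  have hm : MeasurableSet (Icc a b ∪ Icc a' b') := measurableSet_Icc.union measurableSet_Icc
  calc ∫⁻ x, ENNReal.ofReal (f x)
      ≤ ∫⁻ x, (Icc a b ∪ Icc a' b').indicator (fun _ => ENNReal.ofReal c) x := by
        apply lintegral_mono
        intro x
        by_cases hx : x ∈ Icc a b ∪ Icc a' b'
        · simp only [indicator_of_mem hx]
          exact ENNReal.ofReal_le_ofReal (h1 x)
        · simp [indicator_of_notMem hx, h2 x hx]
    _ = ENNReal.ofReal c * volume (Icc a b ∪ Icc a' b') := lintegral_indicator_const hm _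
    _ ≤ ENNReal.ofReal c * (volume (Icc a b) + volume (Icc a' b')) := by
        gcongr
        exact measure_union_le _ _
    _ = _ := by
        rw [Real.volume_Icc, Real.volume_Icc, ← ENNReal.ofReal_add (by linarith) (by linarith),
          ← ENNReal.ofReal_mul hc]

theorem aux_mid (ρ ℓ : ℝ) (hρ : 0 < ρ) (h : ρ ≤ ℓ) :
    ∫⁻ x in Ioc ρ ℓ, ENNReal.ofReal (4 / x) = ENNReal.ofReal (4 * Real.log (ℓ/ρ)) := by
  have h0 : (0:ℝ) ∉ uIcc ρ ℓ := by
    rw [uIcc_of_le h]; intro h'; exact absurd h'.1 (not_le.2 hρ)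
  have hi : IntervalIntegrable (fun x : ℝ => 4 / x) volume ρ ℓ := by
    simp only [div_eq_mul_inv]
    apply IntervalIntegrable.const_mul
    exact intervalIntegral.intervalIntegrable_inv (fun x hx hx0 => h0 (hx0 ▸ hx)) continuousOn_id
  rw [← ofReal_integral_eq_lintegral_ofReal]
  · rw [← intervalIntegral.integral_of_le h]
    simp only [div_eq_mul_inv]
    rw [intervalIntegral.integral_const_mul, integral_inv h0, div_eq_mul_inv]
  · exact (intervalIntegrable_iff_integrableOn_Ioc_of_le h).1 hi
  · filter_upwards [ae_restrict_mem measurableSet_Ioc] with x hx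
    have : 0 < x := hρ.trans hx.1
    simp only [Pi.zero_apply]
    positivity

theorem aux_tail (ℓ : ℝ) (hl : 0 < ℓ) :
    ∫⁻ x in Ioi ℓ, ENNReal.ofReal (4 * ℓ * x ^ (-2:ℝ)) = ENNReal.ofReal 4 := by
  rw [← ofReal_integral_eq_lintegral_ofReal]
  · rw [integral_const_mul, integral_Ioi_rpow_of_lt (by norm_num) hl]
    congr 1
    have : (-2:ℝ) + 1 = -1 := by norm_num
    rw [this, Real.rpow_neg_one]
    field_simp
  · exact (integrableOn_Ioi_rpow_of_lt (by norm_num) hl).const_mul _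
  · filter_upwards [ae_restrict_mem measurableSet_Ioi] with x hx
    have : 0 < x := hl.trans hx
    simp only [Pi.zero_apply]
    positivity

/-- `H^{1/2}`-seminorm bound for the trapezoidal test function. -/
theorem trapezoid_H12_bound :
    ∃ C : ℝ, 0 < C ∧ ∀ ρ ℓ ξ₁' ξ₁ : ℝ, 0 < ρ → ρ ≤ ℓ/2 → ξ₁' ≤ ξ₁ → ξ₁ - ξ₁' ≤ ℓ →
      ∀ ζ : ℝ → ℝ,
        (∀ x1 : ℝ, ξ₁ + ρ ≤ x1 → ζ x1 = 0) →
        (∀ x1 : ℝ, ξ₁ ≤ x1 → x1 ≤ ξ₁ + ρ → ζ x1 = (ξ₁ - x1 + ρ)/ρ) →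
        (∀ x1 : ℝ, ξ₁' ≤ x1 → x1 ≤ ξ₁ → ζ x1 = 1) →
        (∀ x1 : ℝ, ξ₁' - ρ ≤ x1 → x1 ≤ ξ₁' → ζ x1 = (x1 - ξ₁' + ρ)/ρ) →
        (∀ x1 : ℝ, x1 ≤ ξ₁' - ρ → ζ x1 = 0) →
        ∫⁻ x3 in Set.Ioi (0:ℝ),
            ENNReal.ofReal (1/x3^2) * ∫⁻ x1 : ℝ, ENNReal.ofReal ((ζ (x1 + x3) - ζ x1)^2)
          ≤ ENNReal.ofReal (C * (1 + Real.log (ℓ/ρ))) := by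
  refine ⟨8, by norm_num, ?_⟩
  intro ρ ℓ a b hρ hρl hab hbl ζ z1 z2 z3 z4 z5
  have hl : 0 < ℓ := by linarith
  have hform : ∀ x, ρ * ζ x = max 0 (min ρ (min (b - x + ρ) (x - a + ρ))) := by
    intro x
    rcases le_total x a with h | h
    · rcases le_total x (a - ρ) with h' | h'
      · rw [z5 x h', max_eq_left]
        · simp
        · exact (min_le_right _ _).trans ((min_le_right _ _).trans (by linarith))
      · rw [z4 x h' h, min_eq_right (a := b - x + ρ) (by linarith), min_eq_right (by linarith),
          max_eq_right (by linarith)]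
        field_simp
    · rcases le_total x b with h2 | h2
      · rw [z3 x h h2, min_eq_left, max_eq_right hρ.le, mul_one]
        exact le_min (by linarith) (by linarith)
      · rcases le_total x (b + ρ) with h' | h'
        · rw [z2 x h2 h', min_eq_left (a := b - x + ρ) (by linarith), min_eq_right (by linarith),
            max_eq_right (by linarith)]
          field_simp
        · rw [z1 x h', max_eq_left]
          · simp
          · exact (min_le_right _ _).trans ((min_le_left _ _).trans (by linarith))
  have h01 : ∀ x, 0 ≤ ζ x ∧ ζ x ≤ 1 := by
    intro x
    have h := hform x
    have h1 : 0 ≤ ρ * ζ x := by rw [h]; exact le_max_left _ _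
    have h2 : ρ * ζ x ≤ ρ * 1 := by
      rw [h, mul_one]; exact max_le hρ.le (min_le_left _ _)
    exact ⟨nonneg_of_mul_nonneg_right h1 hρ, le_of_mul_le_mul_left h2 hρ⟩
  have hsq1 : ∀ x y, (ζ y - ζ x)^2 ≤ 1 := by
    intro x y
    have := h01 x
    have := h01 y
    rw [sq_le_one_iff_abs_le_one, abs_le]
    constructor <;> linarith
  have hlip : ∀ x t, 0 ≤ t → (ζ (x + t) - ζ x)^2 ≤ t^2 / ρ^2 := by
    intro x t ht
    have e1 := hform x
    have e2 := hform (x + t)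
    have : |ρ * (ζ (x + t) - ζ x)| ≤ t := by
      rw [mul_sub, e1, e2, abs_le]
      constructor <;> grind
    have h3 := sq_le_sq' (abs_le.1 this).1 (abs_le.1 this).2
    rw [le_div_iff₀ (by positivity)]
    nlinarith
  have hzero : ∀ x t, 0 ≤ t → x ∉ Icc (a - ρ - t) a ∪ Icc (b - t) (b + ρ) →
      (ζ (x + t) - ζ x)^2 = 0 := by
    intro x t ht hx
    simp only [mem_union, mem_Icc, not_or, not_and_or, not_le] at hx
    obtain ⟨h1, h2⟩ := hx
    rcases h1 with h1 | h1
    · rw [z5 x (by linarith), z5 (x + t) (by linarith)]; simp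
    · rcases h2 with h2 | h2
      · rw [z3 x (by linarith) (by linarith), z3 (x + t) (by linarith) (by linarith)]; simp
      · rw [z1 x (by linarith), z1 (x + t) (by linarith)]; simp
  have hzero2 : ∀ x t, x ∉ Icc (a - ρ - t) (b + ρ - t) ∪ Icc (a - ρ) (b + ρ) →
      (ζ (x + t) - ζ x)^2 = 0 := by
    have key : ∀ y, ¬ (a - ρ ≤ y ∧ y ≤ b + ρ) → ζ y = 0 := by
      intro y hy
      rcases le_total y (a - ρ) with h | h
      · exact z5 y h
      · exact z1 y (by by_contra h'; exact hy ⟨h, by linarith⟩)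
    intro x t hx
    simp only [mem_union, mem_Icc, not_or] at hx
    rw [key x hx.2, key (x + t) (fun h => hx.1 ⟨by linarith [h.1], by linarith [h.2]⟩)]; simp
  have hset : Ioi (0:ℝ) = Ioc 0 ρ ∪ (Ioc ρ ℓ ∪ Ioi ℓ) := by
    rw [Ioc_union_Ioi_eq_Ioi (by linarith), Ioc_union_Ioi_eq_Ioi hρ.le]
  have hlog : 0 ≤ Real.log (ℓ/ρ) := Real.log_nonneg (by rw [le_div_iff₀ hρ]; linarith)
  rw [hset]
  refine (lintegral_union_le _ _ _).trans ?_
  refine (add_le_add_right (lintegral_union_le _ _ _) _).trans ?_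
  have A : ∫⁻ x3 in Ioc 0 ρ,
            ENNReal.ofReal (1/x3^2) * ∫⁻ x1 : ℝ, ENNReal.ofReal ((ζ (x1 + x3) - ζ x1)^2)
          ≤ ENNReal.ofReal 4 := by
    calc _ ≤ ∫⁻ x3 in Ioc 0 ρ, ENNReal.ofReal (4 / ρ) := by
          apply setLIntegral_mono' measurableSet_Ioc
          intro t ht
          have ht0 : 0 < t := ht.1
          have ht1 : t ≤ ρ := ht.2
          grw [aux_lint (fun x => (ζ (x + t) - ζ x)^2) (t^2/ρ^2) _ _ _ _ (by positivity)
            (by linarith) (by linarith) (fun x => hlip x t ht0.le)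
            (fun x => hzero x t ht0.le)]
          rw [← ENNReal.ofReal_mul (by positivity)]
          apply ENNReal.ofReal_le_ofReal
          have : 1 / t^2 * (t^2/ρ^2 * ((a - (a - ρ - t)) + (b + ρ - (b - t))))
            = 2 * (ρ + t) / ρ^2 := by field_simp; ring
          rw [this, div_le_div_iff₀ (by positivity) hρ]
          nlinarith
      _ = _ := by
          rw [setLIntegral_const, Real.volume_Ioc, ← ENNReal.ofReal_mul (by positivity)]
          congr 1
          field_simp
          ring
  have B : ∫⁻ x3 in Ioc ρ ℓ,
            ENNReal.ofReal (1/x3^2) * ∫⁻ x1 : ℝ, ENNReal.ofReal ((ζ (x1 + x3) - ζ x1)^2)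
          ≤ ENNReal.ofReal (4 * Real.log (ℓ/ρ)) := by
    rw [← aux_mid ρ ℓ hρ (by linarith)]
    apply setLIntegral_mono' measurableSet_Ioc
    intro t ht
    have ht1 : ρ < t := ht.1
    have ht0 : 0 < t := hρ.trans ht1
    grw [aux_lint (fun x => (ζ (x + t) - ζ x)^2) 1 _ _ _ _ (by positivity)
      (by linarith) (by linarith) (fun x => hsq1 _ _)
      (fun x => hzero x t ht0.le)]
    rw [← ENNReal.ofReal_mul (by positivity)]
    apply ENNReal.ofReal_le_ofReal
    have : 1 / t^2 * (1 * ((a - (a - ρ - t)) + (b + ρ - (b - t))))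
      = 2 * (ρ + t) / t^2 := by field_simp; ring
    rw [this, div_le_div_iff₀ (by positivity) ht0]
    nlinarith
  have D : ∫⁻ x3 in Ioi ℓ,
            ENNReal.ofReal (1/x3^2) * ∫⁻ x1 : ℝ, ENNReal.ofReal ((ζ (x1 + x3) - ζ x1)^2)
          ≤ ENNReal.ofReal 4 := by
    rw [← aux_tail ℓ hl]
    apply setLIntegral_mono' measurableSet_Ioi
    intro t ht
    have ht0 : 0 < t := hl.trans ht
    grw [aux_lint (fun x => (ζ (x + t) - ζ x)^2) 1 _ _ _ _ (by positivity)
      (by linarith) (by linarith) (fun x => hsq1 _ _)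
      (fun x => hzero2 x t)]
    rw [← ENNReal.ofReal_mul (by positivity)]
    apply ENNReal.ofReal_le_ofReal
    have e : t ^ (-2:ℝ) = 1 / t^2 := by
      rw [Real.rpow_neg ht0.le, one_div]; norm_num
    rw [e, mul_comm]
    refine mul_le_mul_of_nonneg_right ?_ (by positivity)
    linarith
  refine (add_le_add A (add_le_add B D)).trans ?_
  rw [← ENNReal.ofReal_add (by positivity) (by norm_num),
    ← ENNReal.ofReal_add (by norm_num) (by positivity)]
  apply ENNReal.ofReal_le_ofReal
  linarith

end
end
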